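/- Let n ≥ 48 be divisible by 4 and let L_n be the set of pairs (U, V) of subsets of [n] with U ∩ V ≠ ∅, viewed as subsets of the ground set Z = {x_1,...,x_n, y_1,...,y_n} (identifying (U,V) with {x_i : i ∈ U} ∪ {y_j : j ∈ V}). Suppose L_n = R_1 ∪ ... ∪ R_ℓ where the R_i are pairwise disjoint and each R_i is an ordered balanced set rectangle, i.e., there is an interval [a, b] ⊆ [1, 2n] with n·2/3 ≤ b − a + 1 ≤ 4n/3 inducing a partition (Π₀, Π₁) of Z, and sets S ⊆ 𝒫(Π₀), T ⊆ 𝒫(Π₁) with R_i = {s ∪ t : s ∈ S, t ∈ T}. Then ℓ ≥ 2^{cn} for some absolute constant c > 0. -/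

import Mathlib

/-- The ground set `Z` is modelled (0-indexed) as `Fin (2*n)`, with `x_i` the element `i`
(for `i < n`) and `y_j` the element `j + n`.  A pair `(U, V)` of subsets of `[n]` is
identified with the subset `{x_i : i ∈ U} ∪ {y_j : j ∈ V}` of `Z`; under this
identification every subset of `Z` encodes a pair, and `L_n` corresponds to the subsets
below.  `R` is an ordered balanced set rectangle: it arises from a partition of `Z`
induced by an interval `[a, b]` of length between `2n/3` and `4n/3` (stated
multiplicatively), with `S` consisting of subsets of the interval part and `T` of subsets
of its complement. -/
def IsOrderedBalancedRect (n : ℕ) (R : Set (Finset (Fin (2 * n)))) : Prop :=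
  ∃ a b : ℕ, a ≤ b ∧ b < 2 * n ∧
    2 * n ≤ 3 * (b - a + 1) ∧ 3 * (b - a + 1) ≤ 4 * n ∧
    ∃ S T : Set (Finset (Fin (2 * n))),
      (∀ s ∈ S, ∀ z ∈ s, a ≤ z.1 ∧ z.1 ≤ b) ∧
      (∀ t ∈ T, ∀ z ∈ t, z.1 < a ∨ b < z.1) ∧
      R = {u | ∃ s ∈ S, ∃ t ∈ T, u = s ∪ t}

open Finset

/-- The local weight of a pair of bits: a symmetric `2 × 2` matrix with orthogonal rows. -/
def bitWeight (a b : Bool) : ℝ :=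
  if a then (if b then -1 else 4) else (if b then 4 else 1)

lemma bitWeight_comm (a b : Bool) : bitWeight a b = bitWeight b a := by
  cases a <;> cases b <;> simp [bitWeight]

lemma sum_bitWeight_mul (b c : Bool) :
    ∑ a, bitWeight a b * bitWeight a c = if b = c then 17 else 0 := by
  cases b <;> cases c <;> simp [bitWeight] <;> norm_num

lemma sum_prod_bitWeight_mul {ι : Type*} [Fintype ι] [DecidableEq ι] (v w : ι → Bool) :
    ∑ u : ι → Bool, (∏ i, bitWeight (u i) (v i)) * ∏ i, bitWeight (u i) (w i) =
      if v = w then 17 ^ Fintype.card ι else 0 := by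
  simp_rw [← prod_mul_distrib]
  rw [← Fintype.piFinset_univ, ← prod_univ_sum (fun _ => univ)
    (fun i a => bitWeight a (v i) * bitWeight a (w i))]
  simp_rw [sum_bitWeight_mul]
  split_ifs with h
  · subst h; simp
  · obtain ⟨i, hi⟩ := Function.ne_iff.1 h
    exact prod_eq_zero (mem_univ i) (if_neg hi)

/-- Lindsey-type bound for the tensor power of `bitWeight`. -/
lemma sq_sum_bilin_bitWeight_le {ι : Type*} [Fintype ι] [DecidableEq ι]
    (A B : (ι → Bool) → ℝ) (hA : ∀ u, |A u| ≤ 1) (hB : ∀ v, |B v| ≤ 1) :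
    (∑ u, ∑ v, A u * B v * ∏ i, bitWeight (u i) (v i)) ^ 2 ≤ 68 ^ Fintype.card ι := by
  have hsq : ∀ C : (ι → Bool) → ℝ, (∀ u, |C u| ≤ 1) →
      ∑ u, C u ^ 2 ≤ 2 ^ Fintype.card ι := by
    intro C hC
    calc ∑ u, C u ^ 2 ≤ ∑ _u : ι → Bool, (1 : ℝ) :=
          sum_le_sum fun u _ => (sq_le_one_iff_abs_le_one _).2 (hC u)
      _ = 2 ^ Fintype.card ι := by simp
  have hcol : ∑ u : ι → Bool, (∑ v, B v * ∏ i, bitWeight (u i) (v i)) ^ 2 =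
      17 ^ Fintype.card ι * ∑ v, B v ^ 2 := by
    calc _ = ∑ u : ι → Bool, ∑ v, ∑ w, B v * B w *
            ((∏ i, bitWeight (u i) (v i)) * ∏ i, bitWeight (u i) (w i)) := by
          refine sum_congr rfl fun u _ => ?_
          rw [sq, sum_mul_sum]
          exact sum_congr rfl fun v _ => sum_congr rfl fun w _ => by ring
      _ = ∑ v, ∑ w, B v * B w * ∑ u : ι → Bool,
            ((∏ i, bitWeight (u i) (v i)) * ∏ i, bitWeight (u i) (w i)) := by
          rw [sum_comm]
          refine sum_congr rfl fun v _ => ?_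
          rw [sum_comm]
          simp_rw [mul_sum]
      _ = _ := by
          simp_rw [sum_prod_bitWeight_mul]
          simp [mul_sum, sq, mul_comm]
  calc _ = (∑ u, A u * ∑ v, B v * ∏ i, bitWeight (u i) (v i)) ^ 2 := by
        simp_rw [mul_sum, mul_assoc]
    _ ≤ (∑ u, A u ^ 2) * ∑ u : ι → Bool, (∑ v, B v * ∏ i, bitWeight (u i) (v i)) ^ 2 :=
        sum_mul_sq_le_sq_mul_sq _ _ _
    _ ≤ 2 ^ Fintype.card ι * (17 ^ Fintype.card ι * 2 ^ Fintype.card ι) := by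
        rw [hcol]
        gcongr
        · exact hsq A hA
        · exact hsq B hB
    _ = 68 ^ Fintype.card ι := by
        rw [← mul_pow, ← mul_pow]; norm_num

lemma sum_pair_prod {ι : Type*} [Fintype ι] [DecidableEq ι] (g : Bool → Bool → ℝ) :
    ∑ u : ι → Bool, ∑ v : ι → Bool, ∏ i, g (u i) (v i) =
      (∑ a, ∑ b, g a b) ^ Fintype.card ι := by
  have h : ∀ u : ι → Bool, ∑ v : ι → Bool, ∏ i, g (u i) (v i) = ∏ i, ∑ b, g (u i) b := by
    intro u
    rw [prod_univ_sum, Fintype.piFinset_univ]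
  simp_rw [h]
  rw [← Fintype.piFinset_univ, ← prod_univ_sum (fun _ => univ) (fun _ a => ∑ b, g a b)]
  simp

/-- If `A` ignores the `v`-bits and `B` ignores the `u`-bits on the coordinates satisfying `p`,
then these coordinates contribute a factor `√68` each and the others a factor `10`. -/
lemma abs_sum_bitWeight_le {ι : Type*} [Fintype ι] [DecidableEq ι] (p : ι → Prop)
    [DecidablePred p] (A B : (ι → Bool) → (ι → Bool) → ℝ)
    (hA : ∀ u v, |A u v| ≤ 1) (hB : ∀ u v, |B u v| ≤ 1)
    (hAv : ∀ u v v', (∀ i, ¬ p i → v i = v' i) → A u v = A u v')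
    (hBu : ∀ u u' v, (∀ i, ¬ p i → u i = u' i) → B u v = B u' v) :
    |∑ u, ∑ v, A u v * B u v * ∏ i, bitWeight (u i) (v i)| ≤
      10 ^ Fintype.card {i // ¬ p i} * √68 ^ Fintype.card {i // p i} := by
  let e := Equiv.piEquivPiSubtypeProd p (fun _ => Bool)
  have hsplit : ∀ F : (ι → Bool) → ℝ, ∑ u, F u = ∑ c, ∑ x, F (e.symm (x, c)) := by
    intro F
    rw [← Equiv.sum_comp e.symm F, Fintype.sum_prod_type, sum_comm]
  have hprod : ∀ x y c d, ∏ i, bitWeight (e.symm (x, c) i) (e.symm (y, d) i) =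
      (∏ i, bitWeight (c i) (d i)) * ∏ i, bitWeight (x i) (y i) := by
    intro x y c d
    rw [← Fintype.prod_subtype_mul_prod_subtype p, mul_comm]
    congr 1
    · refine prod_congr rfl fun i _ => ?_
      simp [e, Equiv.piEquivPiSubtypeProd, i.2]
    · refine prod_congr rfl fun i _ => ?_
      simp [e, Equiv.piEquivPiSubtypeProd, i.2]
  have hoff : ∀ x y c, ∀ i, ¬ p i → e.symm (x, c) i = e.symm (y, c) i := by
    intro x y c i hi
    simp [e, Equiv.piEquivPiSubtypeProd, hi]
  have hfix : ∀ c d, |∑ x, ∑ y, A (e.symm (x, c)) (e.symm (y, d)) *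
      B (e.symm (x, c)) (e.symm (y, d)) * ∏ i, bitWeight (x i) (y i)| ≤
        √68 ^ Fintype.card {i // p i} := by
    intro c d
    have h := sq_sum_bilin_bitWeight_le
      (fun x => A (e.symm (x, c)) (e.symm (fun _ => false, d)))
      (fun y => B (e.symm (fun _ => false, c)) (e.symm (y, d)))
      (fun _ => hA _ _) (fun _ => hB _ _)
    refine abs_le_of_sq_le_sq ?_ (by positivity)
    rw [← pow_mul, mul_comm _ 2, pow_mul, Real.sq_sqrt (by norm_num)]
    refine le_of_eq_of_le ?_ h
    congr 1
    refine sum_congr rfl fun x _ => sum_congr rfl fun y _ => ?_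
    rw [hAv _ _ _ (hoff y (fun _ => false) d), hBu _ _ _ (hoff x (fun _ => false) c)]
  have hre : ∑ u, ∑ v, A u v * B u v * ∏ i, bitWeight (u i) (v i) =
      ∑ c, ∑ d, (∏ i, bitWeight (c i) (d i)) *
        ∑ x, ∑ y, A (e.symm (x, c)) (e.symm (y, d)) *
          B (e.symm (x, c)) (e.symm (y, d)) * ∏ i, bitWeight (x i) (y i) := by
    rw [hsplit]
    refine sum_congr rfl fun c _ => ?_
    simp_rw [hsplit (fun v => A _ v * B _ v * _)]
    rw [sum_comm]
    refine sum_congr rfl fun d _ => ?_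
    simp_rw [mul_sum]
    refine sum_congr rfl fun x _ => sum_congr rfl fun y _ => ?_
    rw [hprod]; ring
  rw [hre]
  calc _ ≤ ∑ c : {i // ¬ p i} → Bool, ∑ d : {i // ¬ p i} → Bool,
        (∏ i, |bitWeight (c i) (d i)|) * √68 ^ Fintype.card {i // p i} := by
        refine (abs_sum_le_sum_abs _ _).trans (sum_le_sum fun c _ => ?_)
        refine (abs_sum_le_sum_abs _ _).trans (sum_le_sum fun d _ => ?_)
        rw [abs_mul, abs_prod]
        exact mul_le_mul_of_nonneg_left (hfix c d) (prod_nonneg fun _ _ => abs_nonneg _)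
    _ = _ := by
        simp_rw [← sum_mul]
        rw [sum_pair_prod (fun a b => |bitWeight a b|)]
        congr 2
        simp [bitWeight]; norm_num

/-- The position of `x_i` in the ground set. -/
def xPos {n : ℕ} (i : Fin n) : Fin (2 * n) := i.castLE (by omega)

/-- The position of `y_i` in the ground set. -/
def yPos {n : ℕ} (i : Fin n) : Fin (2 * n) := (i.addNat n).castLE (by omega)

lemma pos_cases {n : ℕ} (z : Fin (2 * n)) : ∃ i, z = xPos i ∨ z = yPos i := by
  by_cases h : z.1 < n
  · exact ⟨⟨z.1, h⟩, Or.inl rfl⟩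
  · exact ⟨⟨z.1 - n, by omega⟩, Or.inr (Fin.ext (by simp [yPos]; omega))⟩

lemma xPos_ne_yPos {n : ℕ} (i j : Fin n) : xPos i ≠ yPos j := by
  intro h
  have := congrArg Fin.val h
  simp only [xPos, yPos, Fin.val_castLE, Fin.val_addNat] at this
  omega

lemma xPos_inj {n : ℕ} {i j : Fin n} : xPos i = xPos j ↔ i = j := by
  simp [xPos, Fin.ext_iff]

lemma yPos_inj {n : ℕ} {i j : Fin n} : yPos i = yPos j ↔ i = j := by
  simp [yPos, Fin.ext_iff]

/-- Subsets of the ground set as pairs of bit vectors, where the roles of `x_i` and `y_i` are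
exchanged for the indices `i` selected by `σ`. -/
def bitsEquiv {n : ℕ} (σ : Fin n → Bool) :
    Finset (Fin (2 * n)) ≃ (Fin n → Bool) × (Fin n → Bool) where
  toFun w := (fun i => bif σ i then decide (yPos i ∈ w) else decide (xPos i ∈ w),
    fun i => bif σ i then decide (xPos i ∈ w) else decide (yPos i ∈ w))
  invFun q := univ.filter fun z => ∃ i,
    (z = xPos i ∧ (bif σ i then q.2 i else q.1 i) = true) ∨
      (z = yPos i ∧ (bif σ i then q.1 i else q.2 i) = true)
  left_inv w := by
    ext z
    obtain ⟨i, rfl | rfl⟩ := pos_cases z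
    · simp only [mem_filter, mem_univ, true_and, xPos_inj, xPos_ne_yPos, false_and, or_false,
        exists_eq_left']
      cases h : σ i <;> simp
    · simp only [mem_filter, mem_univ, true_and, yPos_inj, (xPos_ne_yPos _ _).symm, false_and,
        false_or, exists_eq_left']
      cases h : σ i <;> simp
  right_inv q := by
    have hx : ∀ i j : Fin n, (yPos i = xPos j) = False :=
      fun i j => eq_false (xPos_ne_yPos j i).symm
    ext i <;> cases h : σ i <;> simp [xPos_inj, yPos_inj, xPos_ne_yPos, hx, h]

lemma xPos_mem_bitsEquiv_symm {n : ℕ} (σ : Fin n → Bool) (q : (Fin n → Bool) × (Fin n → Bool))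
    (i : Fin n) :
    xPos i ∈ (bitsEquiv σ).symm q ↔ (bif σ i then q.2 i else q.1 i) = true := by
  simp [bitsEquiv, xPos_inj, xPos_ne_yPos]

lemma yPos_mem_bitsEquiv_symm {n : ℕ} (σ : Fin n → Bool) (q : (Fin n → Bool) × (Fin n → Bool))
    (i : Fin n) :
    yPos i ∈ (bitsEquiv σ).symm q ↔ (bif σ i then q.1 i else q.2 i) = true := by
  simp [bitsEquiv, yPos_inj, (xPos_ne_yPos _ _).symm]

/-- The signed weight of a subset of the ground set. -/
def setWeight {n : ℕ} (w : Finset (Fin (2 * n))) : ℝ :=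
  ∏ i : Fin n, bitWeight (decide (xPos i ∈ w)) (decide (yPos i ∈ w))

lemma setWeight_bitsEquiv_symm {n : ℕ} (σ : Fin n → Bool)
    (q : (Fin n → Bool) × (Fin n → Bool)) :
    setWeight ((bitsEquiv σ).symm q) = ∏ i, bitWeight (q.1 i) (q.2 i) := by
  refine prod_congr rfl fun i _ => ?_
  simp only [xPos_mem_bitsEquiv_symm, yPos_mem_bitsEquiv_symm, Bool.decide_eq_true]
  cases σ i
  · rfl
  · exact bitWeight_comm _ _

lemma sum_setWeight_eq {n : ℕ} (σ : Fin n → Bool) (F : Finset (Fin (2 * n)) → ℝ) :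
    ∑ w, F w * setWeight w = ∑ u : Fin n → Bool, ∑ v : Fin n → Bool,
      F ((bitsEquiv σ).symm (u, v)) * ∏ i, bitWeight (u i) (v i) := by
  rw [← Equiv.sum_comp (bitsEquiv σ).symm, Fintype.sum_prod_type]
  simp_rw [setWeight_bitsEquiv_symm]

open Classical in
lemma sum_setWeight_intersecting (n : ℕ) :
    ∑ w : Finset (Fin (2 * n)), (if ∃ i : Fin n, xPos i ∈ w ∧ yPos i ∈ w then 1 else 0) *
      setWeight w = 8 ^ n - 9 ^ n := by
  rw [sum_setWeight_eq (fun _ => false)]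
  simp only [xPos_mem_bitsEquiv_symm, yPos_mem_bitsEquiv_symm, cond_false]
  have h8 := sum_pair_prod (ι := Fin n) bitWeight
  have h9 := sum_pair_prod (ι := Fin n)
    (fun a b => if a = true ∧ b = true then 0 else bitWeight a b)
  rw [show ∑ a, ∑ b, bitWeight a b = 8 by simp [bitWeight]; norm_num] at h8
  rw [show (∑ a, ∑ b, if a = true ∧ b = true then 0 else bitWeight a b) = 9 by
    simp [bitWeight]; norm_num] at h9
  rw [Fintype.card_fin] at h8 h9
  rw [← h8, ← h9, ← sum_sub_distrib]
  refine sum_congr rfl fun u _ => ?_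
  rw [← sum_sub_distrib]
  refine sum_congr rfl fun v _ => ?_
  split_ifs with h
  · obtain ⟨i, hi⟩ := h
    have hz := prod_eq_zero
      (f := fun i => if u i = true ∧ v i = true then 0 else bitWeight (u i) (v i))
      (mem_univ i) (if_pos hi)
    rw [hz]
    ring
  · push Not at h
    rw [eq_comm, zero_mul, sub_eq_zero]
    exact prod_congr rfl fun i _ => (if_neg fun hi => h i hi.1 hi.2).symm

/-- An interval whose length lies between `2n/3` and `4n/3` separates `x_i` from `y_i` for at
least `2n/3` indices `i`. -/
lemma two_mul_le_card_separated {n a b : ℕ} (hab : a ≤ b) (hb : b < 2 * n)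
    (h₁ : 2 * n ≤ 3 * (b - a + 1)) (h₂ : 3 * (b - a + 1) ≤ 4 * n) :
    2 * n ≤ 3 * Fintype.card
      {i : Fin n // ¬ ((a ≤ i.1 ∧ i.1 ≤ b) ↔ (a ≤ i.1 + n ∧ i.1 + n ≤ b))} := by
  have hlen : ∑ i : Fin n, ((if a ≤ i.1 ∧ i.1 ≤ b then 1 else 0) +
      (if a ≤ i.1 + n ∧ i.1 + n ≤ b then 1 else 0)) = b - a + 1 := by
    rw [Fin.sum_univ_eq_sum_range (fun i => (if a ≤ i ∧ i ≤ b then 1 else 0) +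
      (if a ≤ i + n ∧ i + n ≤ b then 1 else 0)) n, sum_add_distrib]
    simp_rw [add_comm _ n]
    rw [← sum_range_add (fun z => if a ≤ z ∧ z ≤ b then 1 else 0), ← card_filter,
      show {z ∈ range (n + n) | a ≤ z ∧ z ≤ b} = Icc a b by
        ext z; simp only [mem_filter, mem_range, mem_Icc]; omega]
    simp; omega
  rw [Fintype.card_subtype, card_filter]
  by_cases hboth : ∃ j : Fin n, a ≤ j.1 ∧ j.1 + n ≤ b
  · obtain ⟨j, hj⟩ := hboth
    have hsum : ∑ i : Fin n, ((if a ≤ i.1 ∧ i.1 ≤ b then 1 else 0) +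
        (if a ≤ i.1 + n ∧ i.1 + n ≤ b then 1 else 0)) +
        ∑ i : Fin n, (if ¬ ((a ≤ i.1 ∧ i.1 ≤ b) ↔ (a ≤ i.1 + n ∧ i.1 + n ≤ b)) then 1 else 0)
        = ∑ _i : Fin n, 2 := by
      rw [← sum_add_distrib]
      refine sum_congr rfl fun i _ => ?_
      split_ifs <;> omega
    simp only [sum_const, card_univ, Fintype.card_fin, smul_eq_mul] at hsum
    omega
  · have hsum : ∑ i : Fin n, ((if a ≤ i.1 ∧ i.1 ≤ b then 1 else 0) +
        (if a ≤ i.1 + n ∧ i.1 + n ≤ b then 1 else 0)) =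
        ∑ i : Fin n,
          (if ¬ ((a ≤ i.1 ∧ i.1 ≤ b) ↔ (a ≤ i.1 + n ∧ i.1 + n ≤ b)) then 1 else 0) := by
      refine sum_congr rfl fun i _ => ?_
      have : ¬ (a ≤ i.1 ∧ i.1 + n ≤ b) := fun h => hboth ⟨i, h⟩
      split_ifs <;> omega
    omega

open Classical in
/-- Every ordered balanced rectangle has small discrepancy with respect to `setWeight`. -/
lemma IsOrderedBalancedRect.abs_sum_pow_le {n : ℕ} {R : Set (Finset (Fin (2 * n)))}
    (hR : IsOrderedBalancedRect n R) :
    |∑ w, (if w ∈ R then 1 else 0) * setWeight w| ^ 3 ≤ 680 ^ n := by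
  obtain ⟨a, b, hab, hb, h₁, h₂, S, T, hS, hT, hST⟩ := hR
  let I : Finset (Fin (2 * n)) := univ.filter fun z => a ≤ z.1 ∧ z.1 ≤ b
  have hI : ∀ z, z ∈ I ↔ a ≤ z.1 ∧ z.1 ≤ b := fun z => by simp [I]
  have hmem : ∀ w, w ∈ R ↔ w ∩ I ∈ S ∧ w \ I ∈ T := by
    intro w
    rw [hST]
    constructor
    · rintro ⟨s, hs, t, ht, rfl⟩
      have hsI : s ⊆ I := fun z hz => (hI z).2 (hS s hs z hz)
      have htI : Disjoint t I := by
        refine disjoint_left.2 fun z hz hzI => ?_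
        have := hT t ht z hz
        have := (hI z).1 hzI
        omega
      rw [union_inter_distrib_right, union_sdiff_distrib, inter_eq_left.2 hsI,
        disjoint_iff_inter_eq_empty.1 htI, sdiff_eq_empty_iff_subset.2 hsI,
        sdiff_eq_self_of_disjoint htI, union_empty, empty_union]
      exact ⟨hs, ht⟩
    · rintro ⟨hs, ht⟩
      exact ⟨_, hs, _, ht, by rw [union_comm, sdiff_union_inter]⟩
  let p : Fin n → Prop := fun i => ¬ ((a ≤ i.1 ∧ i.1 ≤ b) ↔ (a ≤ i.1 + n ∧ i.1 + n ≤ b))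
  let σ : Fin n → Bool := fun i =>
    decide (¬ (a ≤ i.1 ∧ i.1 ≤ b) ∧ (a ≤ i.1 + n ∧ i.1 + n ≤ b))
  have hxI : ∀ i : Fin n, xPos i ∈ I ↔ a ≤ i.1 ∧ i.1 ≤ b := fun i => hI _
  have hyI : ∀ i : Fin n, yPos i ∈ I ↔ a ≤ i.1 + n ∧ i.1 + n ≤ b := fun i => hI _
  have hcard : 2 * n ≤ 3 * Fintype.card {i // p i} := by
    convert two_mul_le_card_separated hab hb h₁ h₂
  have key := abs_sum_bitWeight_le p
    (fun u v => if (bitsEquiv σ).symm (u, v) ∩ I ∈ S then 1 else 0)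
    (fun u v => if (bitsEquiv σ).symm (u, v) \ I ∈ T then 1 else 0)
    (fun u v => by split_ifs <;> simp) (fun u v => by split_ifs <;> simp)
    (fun u v v' h => by
      have : (bitsEquiv σ).symm (u, v) ∩ I = (bitsEquiv σ).symm (u, v') ∩ I := by
        ext z
        obtain ⟨i, rfl | rfl⟩ := pos_cases z
        · simp only [mem_inter, xPos_mem_bitsEquiv_symm, hxI]
          refine and_congr_left fun hz => ?_
          simp only [σ, hz]; simp
        · simp only [mem_inter, yPos_mem_bitsEquiv_symm, hyI]
          refine and_congr_left fun hz => ?_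
          by_cases hx : a ≤ i.1 ∧ i.1 ≤ b
          · simp [σ, hx, h i (by simp [p, hx, hz])]
          · simp only [σ, hx, hz]; simp
      simp only [this])
    (fun u u' v h => by
      have : (bitsEquiv σ).symm (u, v) \ I = (bitsEquiv σ).symm (u', v) \ I := by
        ext z
        obtain ⟨i, rfl | rfl⟩ := pos_cases z
        · simp only [mem_sdiff, xPos_mem_bitsEquiv_symm, hxI]
          refine and_congr_left fun hz => ?_
          by_cases hy : a ≤ i.1 + n ∧ i.1 + n ≤ b
          · simp only [σ, hy, hz]; simp
          · have := h i (by simp only [p, hy, hz]; simp)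
            simp only [σ, hy, hz]; simp [this]
        · simp only [mem_sdiff, yPos_mem_bitsEquiv_symm, hyI]
          refine and_congr_left fun hz => ?_
          simp only [σ, hz]; simp
      simp only [this])
  have hsum : ∑ w, (if w ∈ R then 1 else 0) * setWeight w =
      ∑ u : Fin n → Bool, ∑ v : Fin n → Bool,
        (if (bitsEquiv σ).symm (u, v) ∩ I ∈ S then 1 else 0) *
        (if (bitsEquiv σ).symm (u, v) \ I ∈ T then 1 else 0) *
          ∏ i, bitWeight (u i) (v i) := by
    rw [sum_setWeight_eq σ]
    refine sum_congr rfl fun u _ => sum_congr rfl fun v _ => ?_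
    simp only [hmem, ite_and, ite_mul, one_mul, zero_mul]
  rw [hsum]
  have hcompl := Fintype.card_subtype_compl p
  rw [Fintype.card_fin] at hcompl
  have hle : Fintype.card {i // p i} ≤ n := by
    simpa using Fintype.card_subtype_le p
  generalize Fintype.card {i // p i} = k at *
  rw [hcompl] at key
  obtain ⟨j, hj⟩ := Nat.exists_eq_add_of_le hcard
  have hn : n = 3 * (n - k) + j := by omega
  calc _ ≤ ((10 : ℝ) ^ (n - k) * √68 ^ k) ^ 3 := by gcongr
    _ = 10 ^ (3 * (n - k)) * √68 ^ j * (√68 ^ 2) ^ n := by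
        rw [mul_pow, ← pow_mul, ← pow_mul, ← pow_mul, mul_assoc, ← pow_add]
        congr 2 <;> omega
    _ ≤ 10 ^ (3 * (n - k)) * 10 ^ j * (√68 ^ 2) ^ n := by
        gcongr
        rw [Real.sqrt_le_left (by norm_num)]; norm_num
    _ = 680 ^ n := by
        rw [← pow_add, ← hn, ← mul_pow, Real.sq_sqrt (by norm_num)]; norm_num

open Classical in
/-- Lower bound on the number of disjoint ordered balanced rectangles that cover exactly the
intersecting pairs. -/
lemma pow_sub_pow_cube_le {n ℓ : ℕ} (R : Fin ℓ → Set (Finset (Fin (2 * n))))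
    (hR : ∀ i, IsOrderedBalancedRect n (R i)) (hd : Pairwise (Function.onFun Disjoint R))
    (hU : (⋃ i, R i) = {w | ∃ i : Fin n, xPos i ∈ w ∧ yPos i ∈ w}) :
    ((9 : ℝ) ^ n - 8 ^ n) ^ 3 ≤ ℓ ^ 3 * 680 ^ n := by
  have hind : ∀ w : Finset (Fin (2 * n)),
      (if ∃ i : Fin n, xPos i ∈ w ∧ yPos i ∈ w then (1 : ℝ) else 0) =
        ∑ i, if w ∈ R i then 1 else 0 := by
    intro w
    have hw : w ∈ (⋃ i, R i) ↔ ∃ i : Fin n, xPos i ∈ w ∧ yPos i ∈ w := by rw [hU]; rfl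
    rw [Set.mem_iUnion] at hw
    simp only [← hw]
    split_ifs with h
    · obtain ⟨i, hi⟩ := h
      rw [sum_eq_single i, if_pos hi]
      · exact fun j _ hj => if_neg fun hwj => Set.disjoint_left.1 (hd hj) hwj hi
      · simp
    · exact (sum_eq_zero fun i _ => if_neg fun hi => h ⟨i, hi⟩).symm
  have htotal := sum_setWeight_intersecting n
  simp_rw [hind, sum_mul] at htotal
  rw [sum_comm] at htotal
  have hbound : ∀ i, |∑ w, (if w ∈ R i then 1 else 0) * setWeight w| ≤
      ((680 : ℝ) ^ n) ^ (1 / 3 : ℝ) := by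
    intro i
    have h := Real.rpow_le_rpow (by positivity) (hR i).abs_sum_pow_le
      (by norm_num : (0 : ℝ) ≤ 1 / 3)
    rwa [← Real.rpow_natCast, ← Real.rpow_mul (abs_nonneg _),
      show ((3 : ℕ) : ℝ) * (1 / 3) = 1 by norm_num, Real.rpow_one] at h
  have hle : (9 : ℝ) ^ n - 8 ^ n ≤ ℓ * ((680 : ℝ) ^ n) ^ (1 / 3 : ℝ) := by
    calc (9 : ℝ) ^ n - 8 ^ n = -(8 ^ n - 9 ^ n) := by ring
      _ ≤ |(8 : ℝ) ^ n - 9 ^ n| := neg_le_abs _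
      _ ≤ ∑ _i : Fin ℓ, ((680 : ℝ) ^ n) ^ (1 / 3 : ℝ) := by
          rw [← htotal]
          exact (abs_sum_le_sum_abs _ _).trans (sum_le_sum fun i _ => hbound i)
      _ = _ := by simp
  have hnonneg : (0 : ℝ) ≤ 9 ^ n - 8 ^ n :=
    sub_nonneg.2 (pow_le_pow_left₀ (by norm_num) (by norm_num) n)
  calc ((9 : ℝ) ^ n - 8 ^ n) ^ 3 ≤ (ℓ * ((680 : ℝ) ^ n) ^ (1 / 3 : ℝ)) ^ 3 := by gcongr
    _ = (ℓ : ℝ) ^ 3 * 680 ^ n := by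
        rw [mul_pow, ← Real.rpow_natCast (((680 : ℝ) ^ n) ^ (1 / 3 : ℝ)),
          ← Real.rpow_mul (by positivity)]
        norm_num

lemma pow_mul_pow_le_cube {n : ℕ} (hn : 48 ≤ n) :
    (51 / 50 : ℝ) ^ n * 680 ^ n ≤ (9 ^ n - 8 ^ n) ^ 3 := by
  obtain ⟨m, rfl⟩ := Nat.exists_eq_add_of_le hn
  have h8 : (8 : ℝ) ^ (48 + m) ≤ 9 ^ (48 + m) / 2 := by
    have : (8 : ℝ) ^ m ≤ 9 ^ m := pow_le_pow_left₀ (by norm_num) (by norm_num) m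
    rw [pow_add, pow_add]
    nlinarith [pow_pos (by norm_num : (0 : ℝ) < 9) m]
  calc (51 / 50 : ℝ) ^ (48 + m) * 680 ^ (48 + m) = (3468 / 5) ^ 48 * (3468 / 5) ^ m := by
        rw [← mul_pow, pow_add]; norm_num
    _ ≤ (729 ^ 48 / 8) * 729 ^ m := by
        gcongr <;> norm_num
    _ = (9 ^ (48 + m) / 2) ^ 3 := by
        have : (729 : ℝ) ^ m = (9 ^ m) ^ 3 := by
          rw [← pow_mul, mul_comm, pow_mul]; norm_num
        rw [this]; ring
    _ ≤ _ := by
        gcongr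
        linarith

theorem stmt_16 :
    ∃ c : ℝ, 0 < c ∧
      ∀ n ℓ : ℕ, 48 ≤ n → 4 ∣ n →
        ∀ R : Fin ℓ → Set (Finset (Fin (2 * n))),
          (∀ i, IsOrderedBalancedRect n (R i)) →
          (Pairwise (Function.onFun Disjoint R)) →
          (⋃ i, R i) = {w : Finset (Fin (2 * n)) |
              ∃ i : Fin n, (⟨i.1, by have := i.2; omega⟩ : Fin (2 * n)) ∈ w ∧
                (⟨i.1 + n, by have := i.2; omega⟩ : Fin (2 * n)) ∈ w} →
          (2 : ℝ) ^ (c * n) ≤ ℓ := by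
  refine ⟨Real.logb 2 (51 / 50) / 3, div_pos (Real.logb_pos (by norm_num) (by norm_num))
    (by norm_num), fun n ℓ hn _ R hR hd hU => ?_⟩
  have h := (pow_mul_pow_le_cube hn).trans (pow_sub_pow_cube_le R hR hd hU)
  have h' : (51 / 50 : ℝ) ^ n ≤ ℓ ^ 3 := le_of_mul_le_mul_right h (by positivity)
  refine le_of_pow_le_pow_left₀ three_ne_zero (by positivity) ?_
  refine le_of_eq_of_le ?_ h'
  rw [← Real.rpow_natCast, ← Real.rpow_mul (by norm_num),
    show Real.logb 2 (51 / 50) / 3 * n * ((3 : ℕ) : ℝ) = Real.logb 2 (51 / 50) * n by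
      push_cast; ring,
    Real.rpow_mul (by norm_num), Real.rpow_logb (by norm_num) (by norm_num) (by norm_num),
    Real.rpow_natCast]
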